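/- Let τ be an 𝔽-stopping time and t ∈ [0, T−1]. Then there exists a 𝔾-stopping time ν̂_t with t ≤ ν̂_t ≤ T a.s. such that P-a.s., E[X²_{ν̂_t} 1_{ν̂_t<τ} + Y²_τ 1_{τ≤ν̂_t} | G_t^τ] = ess sup over 𝔾^τ-stopping times ν with t ≤ ν ≤ T of E[X²_ν 1_{ν<τ} + Y²_τ 1_{τ≤ν} | G_t^τ]. In other words, the uninformed player loses nothing by restricting to 𝔾-stopping times: the essential supremum over the richer class 𝔾^τ is attained by a 𝔾-stopping time. -/

import Mathlib

open MeasureTheory ProbabilityTheory Set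

/-- `W` is an essential supremum (w.r.t. `μ`) of the family of functions `S`. -/
def IsEssSupOfFamily {Ω : Type*} [MeasurableSpace Ω] (μ : Measure Ω)
    (S : Set (Ω → ℝ)) (W : Ω → ℝ) : Prop :=
  (∀ f ∈ S, ∀ᵐ ω ∂μ, f ω ≤ W ω) ∧
    ∀ W' : Ω → ℝ, (∀ f ∈ S, ∀ᵐ ω ∂μ, f ω ≤ W' ω) → ∀ᵐ ω ∂μ, W ω ≤ W' ω

lemma trace_aux {Ω : Type*} (G : MeasurableSpace Ω) (τ : Ω → ℕ) (s : ℕ) (A : Set Ω)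
    (hA : MeasurableSet[G ⊔ MeasurableSpace.generateFrom
        {B : Set Ω | ∃ u ≤ s, B = {ω | τ ω ≤ u}}] A) :
    ∃ B, MeasurableSet[G] B ∧ ∀ ω, s < τ ω → (ω ∈ A ↔ ω ∈ B) := by
  let M : MeasurableSpace Ω :=
    { MeasurableSet' := fun A => ∃ B, MeasurableSet[G] B ∧ ∀ ω, s < τ ω → (ω ∈ A ↔ ω ∈ B)
      measurableSet_empty := ⟨∅, @MeasurableSet.empty _ G, fun _ _ => Iff.rfl⟩
      measurableSet_compl := by
        rintro A ⟨B, hB, h⟩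
        exact ⟨Bᶜ, hB.compl, fun ω hω => not_congr (h ω hω)⟩
      measurableSet_iUnion := by
        intro f hf
        choose B hB h using hf
        refine ⟨⋃ i, B i, MeasurableSet.iUnion hB, fun ω hω => ?_⟩
        simp only [mem_iUnion]
        exact exists_congr fun i => h i ω hω }
  have hle : G ⊔ MeasurableSpace.generateFrom
        {B : Set Ω | ∃ u ≤ s, B = {ω | τ ω ≤ u}} ≤ M := by
    refine sup_le (fun A hA => ⟨A, hA, fun _ _ => Iff.rfl⟩) ?_
    apply MeasurableSpace.generateFrom_le
    rintro _ ⟨u, hu, rfl⟩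
    refine ⟨∅, @MeasurableSet.empty _ G, fun ω hω => ?_⟩
    simp only [mem_ofPred_eq, mem_empty_iff_false, iff_false]
    omega
  exact hle A hA

lemma integrable_stopped_aux {Ω : Type*} [mΩ : MeasurableSpace Ω] (μ : Measure Ω)
    (T : ℕ) (P : ℕ → Ω → ℝ) (hP : ∀ s ≤ T, Integrable (P s) μ)
    (ν : Ω → ℕ) (hν : ∀ s, MeasurableSet {ω | ν ω ≤ s}) (hνT : ∀ ω, ν ω ≤ T) :
    Integrable (fun ω => P (ν ω) ω) μ := by
  have hm : Measurable ν := measurable_of_Iic hν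
  have : (fun ω => P (ν ω) ω) =
      fun ω => ∑ s ∈ Finset.range (T + 1), ({ω | ν ω = s}.indicator (P s)) ω := by
    funext ω
    rw [Finset.sum_eq_single (ν ω)]
    · simp
    · intro b _ hb
      simp [Ne.symm hb]
    · intro h
      exact absurd (Finset.mem_range.2 (Nat.lt_succ_of_le (hνT ω))) h
  rw [this]
  refine integrable_finsetSum _ fun s hs => ?_
  exact (hP s (Nat.lt_succ_iff.1 (Finset.mem_range.1 hs))).indicator
    (hm (measurableSet_singleton s))

lemma snell_aux {Ω : Type*} [mΩ : MeasurableSpace Ω] (μ : Measure Ω)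
    [IsProbabilityMeasure μ] (T : ℕ) (G : ℕ → MeasurableSpace Ω)
    (hGmono : Monotone G) (hGle : ∀ s, G s ≤ mΩ)
    (P : ℕ → Ω → ℝ) (hP : ∀ s ≤ T, Integrable (P s) μ) (n : ℕ) :
    ∀ t, t + n = T → ∃ νhat : Ω → ℕ,
      (∀ s, MeasurableSet[G s] {ω | νhat ω ≤ s}) ∧
      (∀ ω, t ≤ νhat ω ∧ νhat ω ≤ T) ∧
      ∀ ν : Ω → ℕ, (∀ s, MeasurableSet[G s] {ω | ν ω ≤ s}) → (∀ ω, t ≤ ν ω ∧ ν ω ≤ T) →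
        ∀ B, MeasurableSet[G t] B →
          ∫ ω in B, P (ν ω) ω ∂μ ≤ ∫ ω in B, P (νhat ω) ω ∂μ := by
  induction n with
  | zero =>
    intro t ht
    obtain rfl : t = T := by omega
    refine ⟨fun _ => t, fun s => ?_, fun _ => ⟨le_rfl, le_rfl⟩, ?_⟩
    · exact MeasurableSet.const (t ≤ s)
    · intro ν _ h2 B _
      have : ν = fun _ => t := funext fun ω => le_antisymm (h2 ω).2 (h2 ω).1
      subst this
      exact le_rfl
  | succ n ih =>
    intro t ht
    obtain ⟨σ, hσ, hσb, hσopt⟩ := ih (t + 1) (by omega)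
    have iσ : Integrable (fun ω => P (σ ω) ω) μ :=
      integrable_stopped_aux μ T P hP σ (fun s => hGle s _ (hσ s)) fun ω => (hσb ω).2
    have iP : Integrable (P t) μ := hP t (by omega)
    let a : Ω → ℝ := μ[P t | G t]
    let b : Ω → ℝ := μ[fun ω => P (σ ω) ω | G t]
    have ha : StronglyMeasurable[G t] a := stronglyMeasurable_condExp
    have hb : StronglyMeasurable[G t] b := stronglyMeasurable_condExp
    let C : Set Ω := {ω | b ω ≤ a ω}
    have hC : MeasurableSet[G t] C := hb.measurableSet_le ha
    -- comparison on subsets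
    have h1 : ∀ S, MeasurableSet[G t] S → S ⊆ C →
        ∫ ω in S, P (σ ω) ω ∂μ ≤ ∫ ω in S, P t ω ∂μ := by
      intro S hS hSC
      rw [← setIntegral_condExp (hGle t) iσ hS, ← setIntegral_condExp (hGle t) iP hS]
      exact setIntegral_mono_on integrable_condExp.integrableOn
        integrable_condExp.integrableOn (hGle t _ hS) fun ω hω => hSC hω
    have h2 : ∀ S, MeasurableSet[G t] S → S ⊆ Cᶜ →
        ∫ ω in S, P t ω ∂μ ≤ ∫ ω in S, P (σ ω) ω ∂μ := by
      intro S hS hSC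
      rw [← setIntegral_condExp (hGle t) iσ hS, ← setIntegral_condExp (hGle t) iP hS]
      exact setIntegral_mono_on integrable_condExp.integrableOn
        integrable_condExp.integrableOn (hGle t _ hS) fun ω hω =>
          (not_le.1 (show ¬ b ω ≤ a ω from hSC hω)).le
    classical
    let νh : Ω → ℕ := fun ω => if ω ∈ C then t else σ ω
    have hνC : ∀ ω ∈ C, νh ω = t := fun ω h => if_pos h
    have hνC' : ∀ ω, ω ∉ C → νh ω = σ ω := fun ω h => if_neg h
    have hνb : ∀ ω, t ≤ νh ω ∧ νh ω ≤ T := by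
      intro ω
      by_cases h : ω ∈ C
      · rw [hνC ω h]; omega
      · rw [hνC' ω h]; have := hσb ω; omega
    have hνm : ∀ s, MeasurableSet[G s] {ω | νh ω ≤ s} := by
      intro s
      by_cases hs : t ≤ s
      · have : {ω | νh ω ≤ s} = C ∪ {ω | σ ω ≤ s} := by
          ext ω
          simp only [mem_ofPred_eq, mem_union]
          by_cases h : ω ∈ C
          · simp [hνC ω h, h, hs]
          · simp [hνC' ω h, h]
        rw [this]
        exact (hGmono hs _ hC).union (hσ s)
      · have : {ω | νh ω ≤ s} = ∅ := by
          ext ω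
          simp only [mem_ofPred_eq, mem_empty_iff_false, iff_false]
          have := hνb ω; omega
        rw [this]
        exact @MeasurableSet.empty _ (G s)
    refine ⟨νh, hνm, hνb, ?_⟩
    intro ν hν hb B hB
    have iν : Integrable (fun ω => P (ν ω) ω) μ :=
      integrable_stopped_aux μ T P hP ν (fun s => hGle s _ (hν s)) fun ω => (hb ω).2
    have iνh : Integrable (fun ω => P (νh ω) ω) μ :=
      integrable_stopped_aux μ T P hP νh (fun s => hGle s _ (hνm s)) fun ω => (hνb ω).2
    let D : Set Ω := {ω | ν ω ≤ t}
    have hD : MeasurableSet[G t] D := hν t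
    have hνD : ∀ ω ∈ D, ν ω = t := fun ω h => le_antisymm h (hb ω).1
    have h3 : ∀ S, MeasurableSet[G t] S → S ⊆ Dᶜ →
        ∫ ω in S, P (ν ω) ω ∂μ ≤ ∫ ω in S, P (σ ω) ω ∂μ := by
      intro S hS hSD
      have := hσopt (fun ω => max (ν ω) (t + 1)) (fun s => ?_) (fun ω => ?_) S
        (hGmono (Nat.le_succ t) _ hS)
      · refine le_trans (le_of_eq ?_) this
        refine setIntegral_congr_fun (hGle t _ hS) fun ω hω => ?_
        have h : ¬ ν ω ≤ t := hSD hω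
        have h' : max (ν ω) (t + 1) = ν ω := by omega
        simp only [h']
      · have : {ω | max (ν ω) (t + 1) ≤ s} = {ω | ν ω ≤ s} ∩ {_ω | t + 1 ≤ s} := by
          ext ω; simp
        rw [this]
        exact (hν s).inter (MeasurableSet.const _)
      · have := hb ω
        omega
    have h4 : ∀ S, MeasurableSet[G t] S → S ⊆ D →
        ∫ ω in S, P (ν ω) ω ∂μ = ∫ ω in S, P t ω ∂μ := by
      intro S hS hSD
      refine setIntegral_congr_fun (hGle t _ hS) fun ω hω => ?_
      simp only [hνD ω (hSD hω)]
    have h5 : ∀ S, MeasurableSet[G t] S → S ⊆ C →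
        ∫ ω in S, P (νh ω) ω ∂μ = ∫ ω in S, P t ω ∂μ := by
      intro S hS hSD
      refine setIntegral_congr_fun (hGle t _ hS) fun ω hω => ?_
      simp only [hνC ω (hSD hω)]
    have h6 : ∀ S, MeasurableSet[G t] S → S ⊆ Cᶜ →
        ∫ ω in S, P (νh ω) ω ∂μ = ∫ ω in S, P (σ ω) ω ∂μ := by
      intro S hS hSD
      refine setIntegral_congr_fun (hGle t _ hS) fun ω hω => ?_
      simp only [hνC' ω (hSD hω)]
    have key : ∀ S, MeasurableSet[G t] S → (S ⊆ D ∨ S ⊆ Dᶜ) →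
        ∫ ω in S, P (ν ω) ω ∂μ ≤ ∫ ω in S, P (νh ω) ω ∂μ := by
      intro S hS hor
      have hS1 := hS.inter hC
      have hS2 := hS.diff hC
      have s1 : S ∩ C ⊆ C := inter_subset_right
      have s2 : S \ C ⊆ Cᶜ := fun ω h => h.2
      rw [← integral_inter_add_sdiff (hGle t _ hC) iν.integrableOn,
        ← integral_inter_add_sdiff (hGle t _ hC) iνh.integrableOn,
        h5 _ hS1 s1, h6 _ hS2 s2]
      rcases hor with h | h
      · rw [h4 _ hS1 (inter_subset_left.trans h), h4 _ hS2 (sdiff_subset.trans h)]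
        exact add_le_add le_rfl (h2 _ hS2 s2)
      · exact add_le_add ((h3 _ hS1 (inter_subset_left.trans h)).trans (h1 _ hS1 s1))
          (h3 _ hS2 (sdiff_subset.trans h))
    rw [← integral_inter_add_sdiff (hGle t _ hD) iν.integrableOn,
      ← integral_inter_add_sdiff (hGle t _ hD) iνh.integrableOn]
    exact add_le_add (key _ (hB.inter hD) (Or.inl inter_subset_right))
      (key _ (hB.diff hD) (Or.inr fun ω h => h.2))

/-- Theorem 1, first part: there is a `𝔾`-stopping time `ν̂_t ∈ [t,T]`
whose conditional payoff attains the essential supremum over all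
`𝔾^τ`-stopping times in `[t,T]`. -/
theorem stmt_6 {Ω : Type*} [mΩ : MeasurableSpace Ω] (μ : Measure Ω)
    [IsProbabilityMeasure μ] (T : ℕ) (hT : 0 < T)
    (F G : ℕ → MeasurableSpace Ω)
    (hFmono : Monotone F) (hFle : ∀ s, F s ≤ mΩ)
    (hGmono : Monotone G) (hGF : ∀ s, G s ≤ F s)
    (X2 Y2 : ℕ → Ω → ℝ)
    (hX2adp : ∀ s ≤ T, Measurable[G s] (X2 s)) (hY2adp : ∀ s ≤ T, Measurable[G s] (Y2 s))
    (hX2int : ∀ s ≤ T, Integrable (X2 s) μ) (hY2int : ∀ s ≤ T, Integrable (Y2 s) μ)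
    (τ : Ω → ℕ) (hτST : ∀ s, MeasurableSet[F s] {ω | τ ω ≤ s}) (hτval : ∀ ω, τ ω ≤ T)
    (t : ℕ) (ht : t ≤ T - 1)
    -- the enlarged σ-algebras G_s^τ
    (Gτ : ℕ → MeasurableSpace Ω)
    (hGτ : ∀ s, Gτ s = G s ⊔ MeasurableSpace.generateFrom
        {B : Set Ω | ∃ u ≤ s, B = {ω | τ ω ≤ u}}) :
    ∃ νhat : Ω → ℕ,
      (∀ s, MeasurableSet[G s] {ω | νhat ω ≤ s}) ∧
      (∀ ω, t ≤ νhat ω ∧ νhat ω ≤ T) ∧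
      IsEssSupOfFamily μ
        {f : Ω → ℝ | ∃ ν : Ω → ℕ,
          (∀ s, MeasurableSet[Gτ s] {ω | ν ω ≤ s}) ∧ (∀ ω, t ≤ ν ω ∧ ν ω ≤ T) ∧
          f = μ[fun ω => if ν ω < τ ω then X2 (ν ω) ω else Y2 (τ ω) ω | Gτ t]}
        (μ[fun ω => if νhat ω < τ ω then X2 (νhat ω) ω else Y2 (τ ω) ω | Gτ t]) := by
  classical
  have hGle : ∀ s, G s ≤ mΩ := fun s => (hGF s).trans (hFle s)
  have hGGτ : ∀ s, G s ≤ Gτ s := fun s => by rw [hGτ s]; exact le_sup_left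
  have hτm : ∀ s, MeasurableSet {ω | τ ω ≤ s} := fun s => hFle s _ (hτST s)
  have hGτle : ∀ s, Gτ s ≤ mΩ := by
    intro s
    rw [hGτ s]
    refine sup_le (hGle s) (MeasurableSpace.generateFrom_le ?_)
    rintro _ ⟨u, _, rfl⟩
    exact hτm u
  have htT : t ≤ T := by omega
  let P : ℕ → Ω → ℝ := fun s ω => if s < τ ω then X2 s ω else Y2 (τ ω) ω
  have hP : ∀ s ≤ T, Integrable (P s) μ := by
    intro s hs
    have hS : MeasurableSet {ω | s < τ ω} := by
      have := (hτm s).compl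
      simpa [compl_ofPred] using this
    have hY := integrable_stopped_aux μ T Y2 hY2int τ hτm hτval
    have hpw : P s = {ω | s < τ ω}.piecewise (X2 s) (fun ω => Y2 (τ ω) ω) := by
      funext ω
      by_cases h : s < τ ω <;> simp [P, Set.piecewise, h]
    rw [hpw]
    exact Integrable.piecewise hS (hX2int s hs).integrableOn hY.integrableOn
  obtain ⟨νh, hm, hb, hopt⟩ := snell_aux μ T G hGmono hGle P hP (T - t) t (by omega)
  refine ⟨νh, hm, hb, ?_, fun W' hW' => hW' _ ⟨νh, fun s => hGGτ s _ (hm s), hb, rfl⟩⟩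
  rintro _ ⟨ν, hν, hνb, rfl⟩
  change μ[fun ω => P (ν ω) ω | Gτ t] ≤ᵐ[μ] μ[fun ω => P (νh ω) ω | Gτ t]
  have iν : Integrable (fun ω => P (ν ω) ω) μ :=
    integrable_stopped_aux μ T P hP ν (fun s => hGτle s _ (hν s)) fun ω => (hνb ω).2
  have iνh : Integrable (fun ω => P (νh ω) ω) μ :=
    integrable_stopped_aux μ T P hP νh (fun s => hGle s _ (hm s)) fun ω => (hb ω).2
  -- reduce to a `𝔾`-stopping time with the same payoff
  have hex : ∃ ν' : Ω → ℕ, (∀ s, MeasurableSet[G s] {ω | ν' ω ≤ s}) ∧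
      (∀ ω, t ≤ ν' ω ∧ ν' ω ≤ T) ∧ ∀ ω, P (ν' ω) ω = P (ν ω) ω := by
    have htr : ∀ s, ∃ B, MeasurableSet[G s] B ∧
        ∀ ω, s < τ ω → (ω ∈ {ω | ν ω ≤ s} ↔ ω ∈ B) := by
      intro s
      have := hν s
      rw [hGτ s] at this
      exact trace_aux (G s) τ s _ this
    choose B hB hBτ using htr
    have hne : ∀ ω, ∃ s, t ≤ s ∧ (s = T ∨ ω ∈ B s) := fun ω => ⟨T, htT, Or.inl rfl⟩
    refine ⟨fun ω => Nat.find (hne ω), fun s => ?_, fun ω => ⟨?_, ?_⟩, fun ω => ?_⟩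
    · have : {ω | Nat.find (hne ω) ≤ s} =
          ⋃ u ∈ Iic s, ({_ω | t ≤ u} ∩ ({_ω | u = T} ∪ B u)) := by
        ext ω
        simp [Nat.find_le_iff, and_left_comm]
      rw [this]
      refine MeasurableSet.biUnion (to_countable _) fun u hu => ?_
      exact (MeasurableSet.const _).inter ((MeasurableSet.const _).union (hGmono hu _ (hB u)))
    · exact (Nat.find_spec (hne ω)).1
    · exact Nat.find_min' (hne ω) ⟨htT, Or.inl rfl⟩
    · have hspec := Nat.find_spec (hne ω)
      by_cases hlt : ν ω < τ ω
      · have : Nat.find (hne ω) = ν ω := by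
          refine le_antisymm (Nat.find_min' (hne ω)
            ⟨(hνb ω).1, Or.inr ((hBτ _ ω hlt).1 (le_refl (ν ω)))⟩) ?_
          by_contra hcon
          have hc : Nat.find (hne ω) < ν ω := not_le.1 hcon
          rcases hspec.2 with h | h
          · have := (hνb ω).2; omega
          · exact hcon ((hBτ _ ω (hc.trans hlt)).2 h)
        simp only [this]
      · have : ¬ Nat.find (hne ω) < τ ω := by
          intro hc
          rcases hspec.2 with h | h
          · have := hτval ω; omega
          · have h' : ν ω ≤ Nat.find (hne ω) := (hBτ _ ω hc).2 h
            omega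
        simp only [P, if_neg this, if_neg hlt]
  obtain ⟨ν', hν'm, hν'b, hν'P⟩ := hex
  have hset : ∀ A, MeasurableSet[Gτ t] A →
      ∫ ω in A, P (ν ω) ω ∂μ ≤ ∫ ω in A, P (νh ω) ω ∂μ := by
    intro A hA
    have hA' := hA
    rw [hGτ t] at hA'
    obtain ⟨B, hB, hAB⟩ := trace_aux (G t) τ t A hA'
    have hlow : ∀ S, MeasurableSet S →
        ∫ ω in S ∩ {ω | τ ω ≤ t}, P (ν ω) ω ∂μ = ∫ ω in S ∩ {ω | τ ω ≤ t}, P (νh ω) ω ∂μ := by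
      intro S hS
      refine setIntegral_congr_fun (hS.inter (hτm t)) fun ω hω => ?_
      have h0 : τ ω ≤ t := hω.2
      have h1 : ¬ ν ω < τ ω := by have := hνb ω; omega
      have h2 : ¬ νh ω < τ ω := by have := hb ω; omega
      simp only [P, if_neg h1, if_neg h2]
    have hdiff : A \ {ω | τ ω ≤ t} = B \ {ω | τ ω ≤ t} := by
      ext ω
      simp only [mem_sdiff, mem_ofPred_eq, not_le]
      exact ⟨fun h => ⟨(hAB ω h.2).1 h.1, h.2⟩, fun h => ⟨(hAB ω h.2).2 h.1, h.2⟩⟩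
    have hBle : ∫ ω in B, P (ν ω) ω ∂μ ≤ ∫ ω in B, P (νh ω) ω ∂μ := by
      have := hopt ν' hν'm hν'b B hB
      simpa only [hν'P] using this
    rw [← integral_inter_add_sdiff (hτm t) iν.integrableOn,
      ← integral_inter_add_sdiff (hτm t) iνh.integrableOn, hlow B (hGle t _ hB)] at hBle
    rw [← integral_inter_add_sdiff (hτm t) iν.integrableOn,
      ← integral_inter_add_sdiff (hτm t) iνh.integrableOn, hlow A (hGτle t _ hA), hdiff]
    linarith
  refine ae_le_of_ae_le_trim (hm := hGτle t) ?_
  have sm1 : StronglyMeasurable[Gτ t] (μ[fun ω => P (ν ω) ω | Gτ t]) := stronglyMeasurable_condExp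
  have sm2 : StronglyMeasurable[Gτ t] (μ[fun ω => P (νh ω) ω | Gτ t]) := stronglyMeasurable_condExp
  refine ae_le_of_forall_setIntegral_le (integrable_condExp.trim (hGτle t) sm1)
    (integrable_condExp.trim (hGτle t) sm2) fun A hA _ => ?_
  rw [← setIntegral_trim (hGτle t) sm1 hA, ← setIntegral_trim (hGτle t) sm2 hA,
    setIntegral_condExp (hGτle t) iν hA, setIntegral_condExp (hGτle t) iνh hA]
  exact hset A hA
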